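/- Let η : ℝ×ℝ² → ℝ³ be C² and set v = ∂_tη. Assume that at every point the 2×2 Gram matrix g_{ij} = ∂_iη^μ∂_jη_μ is invertible, with inverse g^{ij} and determinant g = det(g_{ij}) > 0. Then for every i ∈ {1,2} and α ∈ {1,2,3}, the pointwise identity ∂_t( √g g^{ij} ∂_jη^α ) = √g g^{ij}( δ^α_λ − g^{kl}∂_kη^α∂_lη_λ ) ∂_j v^λ + √g ( g^{ij}g^{kl} − g^{lj}g^{ik} ) ∂_jη^α ∂_kη_λ ∂_l v^λ holds (sums over j,k,l ∈ {1,2} and λ ∈ {1,2,3}). Consequently, if η is C³, then ∂_t( √g Δ_g η^α ) = ∂_i( √g g^{ij}( δ^α_λ − g^{kl}∂_kη^α∂_lη_λ ) ∂_j v^λ + √g ( g^{ij}g^{kl} − g^{lj}g^{ik} ) ∂_jη^α ∂_kη_λ ∂_l v^λ ), where √g Δ_g η^α = ∂_i( √g g^{ij} ∂_jη^α ). -/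

import Mathlib

noncomputable section

/-- Time derivative `∂_t` of a scalar field on `ℝ × ℝ²`. -/
def Dt (f : ℝ × (Fin 2 → ℝ) → ℝ) : ℝ × (Fin 2 → ℝ) → ℝ :=
  fun p => deriv (fun s => f (s, p.2)) p.1

/-- Spatial partial derivative `∂_i` of a scalar field on `ℝ × ℝ²`. -/
def Dx (i : Fin 2) (f : ℝ × (Fin 2 → ℝ) → ℝ) : ℝ × (Fin 2 → ℝ) → ℝ :=
  fun p => fderiv ℝ (fun y => f (p.1, y)) p.2 (Pi.single i 1)

open Real

theorem Dt_eq_fderiv {f : ℝ × (Fin 2 → ℝ) → ℝ} (hf : Differentiable ℝ f) :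
    Dt f = fun p => fderiv ℝ f p (1, 0) := by
  funext p
  exact ((hf p).hasFDerivAt.comp_hasDerivAt p.1
    ((hasDerivAt_id p.1).prodMk (hasDerivAt_const p.1 p.2))).deriv

theorem Dx_eq_fderiv (i : Fin 2) {f : ℝ × (Fin 2 → ℝ) → ℝ} (hf : Differentiable ℝ f) :
    Dx i f = fun p => fderiv ℝ f p (0, Pi.single i 1) := by
  funext p
  have h := ((hf p).hasFDerivAt.comp p.2 (hasFDerivAt_prodMk_right (𝕜 := ℝ) p.1 p.2)).fderiv
  have h' : Dx i f p = fderiv ℝ (f ∘ fun y => (p.1, y)) p.2 (Pi.single i 1) := rfl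
  rw [h', h]
  simp

theorem contDiff_Dt {n : ℕ} {f : ℝ × (Fin 2 → ℝ) → ℝ} (hf : ContDiff ℝ (n + 1) f) :
    ContDiff ℝ n (Dt f) := by
  rw [Dt_eq_fderiv (hf.differentiable (by simp))]
  exact (hf.fderiv_right le_rfl).clm_apply contDiff_const

theorem contDiff_Dx {n : ℕ} (i : Fin 2) {f : ℝ × (Fin 2 → ℝ) → ℝ}
    (hf : ContDiff ℝ (n + 1) f) : ContDiff ℝ n (Dx i f) := by
  rw [Dx_eq_fderiv i (hf.differentiable (by simp))]
  exact (hf.fderiv_right le_rfl).clm_apply contDiff_const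

/-- Space and time derivatives of a `C²` field commute. -/
theorem Dt_Dx_comm (i : Fin 2) {f : ℝ × (Fin 2 → ℝ) → ℝ} (hf : ContDiff ℝ 2 f) :
    Dt (Dx i f) = Dx i (Dt f) := by
  have hf' : ContDiff ℝ ((1 : ℕ) + 1) f := by
    norm_num
    exact hf
  have hd : Differentiable ℝ f := hf.differentiable (by simp)
  have hdd : Differentiable ℝ (fderiv ℝ f) :=
    (hf'.fderiv_right (m := 1) (by simp)).differentiable (by simp)
  rw [Dt_eq_fderiv ((contDiff_Dx i hf').differentiable (by simp)),
    Dx_eq_fderiv i ((contDiff_Dt hf').differentiable (by simp)),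
    Dt_eq_fderiv hd, Dx_eq_fderiv i hd]
  funext p
  have key : ∀ u w, fderiv ℝ (fun q => fderiv ℝ f q u) p w
      = fderiv ℝ (fderiv ℝ f) p w u := by
    intro u w
    rw [fderiv_clm_apply (hdd p) (differentiableAt_const u)]
    simp
  rw [key, key]
  exact (hf.contDiffAt.isSymmSndFDerivAt (by simp)) _ _

theorem hasDerivAt_Dt {f : ℝ × (Fin 2 → ℝ) → ℝ} (hf : Differentiable ℝ f)
    (p : ℝ × (Fin 2 → ℝ)) : HasDerivAt (fun s => f (s, p.2)) (Dt f p) p.1 :=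
  (hf.comp (differentiable_id.prodMk (differentiable_const p.2)) p.1).hasDerivAt

theorem Dt_sum {ι : Type*} (s : Finset ι) {f : ι → ℝ × (Fin 2 → ℝ) → ℝ}
    (hf : ∀ i ∈ s, Differentiable ℝ (f i)) (p : ℝ × (Fin 2 → ℝ)) :
    Dt (fun r => ∑ i ∈ s, f i r) p = ∑ i ∈ s, Dt (f i) p :=
  (HasDerivAt.fun_sum fun i hi => hasDerivAt_Dt (hf i hi) p).deriv

/-- The inverse of a `2 × 2` matrix of positive determinant, by Cramer's rule. -/
theorem inverse_two_by_two {a b : Fin 2 → Fin 2 → ℝ} {d : ℝ}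
    (hd : d = a 0 0 * a 1 1 - a 0 1 * a 1 0) (hd0 : 0 < d)
    (hab : ∀ i j, ∑ k, a i k * b k j = if i = j then 1 else 0) :
    b = ![![a 1 1 / d, -a 0 1 / d], ![-a 1 0 / d, a 0 0 / d]] := by
  have h00 := hab 0 0
  have h01 := hab 0 1
  have h10 := hab 1 0
  have h11 := hab 1 1
  simp [Fin.sum_univ_two] at h00 h01 h10 h11
  funext i j
  fin_cases i <;> fin_cases j <;> simp <;> rw [eq_div_iff hd0.ne', hd]
  · linear_combination a 1 1 * h00 - a 0 1 * h10
  · linear_combination a 1 1 * h01 - a 0 1 * h11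
  · linear_combination a 0 0 * h10 - a 1 0 * h00
  · linear_combination a 0 0 * h11 - a 1 0 * h01

/-- The derivative along a curve of `√g g^{ij} x_j`, where `g` is the Gram matrix of a pair of
vectors in `ℝ³` and `x_j` is the component `α` of the `j`-th vector. -/
theorem hasDerivAt_sqrt_det_mul_inverse_gram {a : Fin 2 → Fin 3 → ℝ → ℝ}
    {w : Fin 2 → Fin 3 → ℝ} {t : ℝ} (ha : ∀ j μ, HasDerivAt (a j μ) (w j μ) t)
    {g ginv : Fin 2 → Fin 2 → ℝ → ℝ} {d : ℝ → ℝ}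
    (hg : ∀ i j s, g i j s = ∑ μ, a i μ s * a j μ s)
    (hd : ∀ s, d s = g 0 0 s * g 1 1 s - g 0 1 s * g 1 0 s) (hd0 : ∀ s, 0 < d s)
    (hginv : ∀ s, (fun i j => ginv i j s)
      = ![![g 1 1 s / d s, -g 0 1 s / d s], ![-g 1 0 s / d s, g 0 0 s / d s]])
    (i : Fin 2) (α : Fin 3) :
    HasDerivAt (fun s => √(d s) * ∑ j, ginv i j s * a j α s)
      ((∑ j, ∑ lam, √(d t) * ginv i j t * ((if α = lam then (1 : ℝ) else 0)
          - ∑ k, ∑ l, ginv k l t * a k α t * a l lam t) * w j lam)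
        + ∑ j, ∑ k, ∑ l, ∑ lam, √(d t) * (ginv i j t * ginv k l t - ginv l j t * ginv i k t)
            * a j α t * a k lam t * w l lam) t := by
  set P : Fin 2 → Fin 2 → ℝ := fun k l => ∑ μ, a k μ t * w l μ with hP
  have hg' : ∀ i j, HasDerivAt (g i j) (P j i + P i j) t := by
    intro i j
    rw [funext (hg i j), hP]
    refine (HasDerivAt.fun_sum fun μ _ => (ha i μ).mul (ha j μ)).congr_deriv ?_
    rw [← Finset.sum_add_distrib]
    exact Finset.sum_congr rfl fun μ _ => by ring
  have hsymm : g 1 0 = g 0 1 := by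
    funext s
    simp only [hg, mul_comm]
  have hd' : HasDerivAt d ((P 0 0 + P 0 0) * g 1 1 t + g 0 0 t * (P 1 1 + P 1 1)
      - ((P 1 0 + P 0 1) * g 0 1 t + g 0 1 t * (P 1 0 + P 0 1))) t := by
    rw [funext hd, hsymm]
    exact ((hg' 0 0).mul (hg' 1 1)).sub ((hg' 0 1).mul (hg' 0 1))
  have hq' := hd'.sqrt (hd0 t).ne'
  have hcol : (∑ j, ∑ lam, √(d t) * ginv i j t * ((if α = lam then (1 : ℝ) else 0)
          - ∑ k, ∑ l, ginv k l t * a k α t * a l lam t) * w j lam)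
        + ∑ j, ∑ k, ∑ l, ∑ lam, √(d t) * (ginv i j t * ginv k l t - ginv l j t * ginv i k t)
            * a j α t * a k lam t * w l lam
      = √(d t) * ((∑ j, ginv i j t * (w j α - ∑ k, ∑ l, ginv k l t * a k α t * P l j))
        + ∑ j, ∑ k, ∑ l, (ginv i j t * ginv k l t - ginv l j t * ginv i k t)
            * a j α t * P k l) := by
    have hsum : w 0 α = ∑ lam, (if α = lam then (1 : ℝ) else 0) * w 0 lam := by simp
    have hsum' : w 1 α = ∑ lam, (if α = lam then (1 : ℝ) else 0) * w 1 lam := by simp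
    simp only [Fin.sum_univ_two, hsum, hsum', hP, Fin.sum_univ_three]
    ring
  have hi : ∀ i j s, ginv i j s
      = ![![g 1 1 s / d s, -g 0 1 s / d s], ![-g 1 0 s / d s, g 0 0 s / d s]] i j :=
    fun i j s => congrFun (congrFun (hginv s) i) j
  have hd0' := (hd0 t).ne'
  have hq0 : √(d t) ≠ 0 := (sqrt_pos.2 (hd0 t)).ne'
  have hG0 : g 1 1 t ≠ 0 := by
    intro h
    have h1 := hd0 t
    rw [hd t, hsymm, h] at h1
    nlinarith [sq_nonneg (g 0 1 t)]
  have hdq : d t = √(d t) ^ 2 := (sq_sqrt (hd0 t).le).symm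
  have hE : g 0 0 t = (√(d t) ^ 2 + g 0 1 t ^ 2) / g 1 1 t := by
    rw [← hdq, hd t, hsymm]
    field_simp
    ring
  rw [hcol]
  simp only [hi, hsymm, Fin.sum_univ_two]
  fin_cases i
  · refine (hq'.mul ((((hg' 1 1).div hd' hd0').mul (ha 0 α)).add
      (((hg' 0 1).neg.div hd' hd0').mul (ha 1 α)))).congr_deriv ?_
    simp
    rw [hE]
    generalize √(d t) = q at *
    rw [hdq]
    field_simp
    ring
  · refine (hq'.mul ((((hg' 0 1).neg.div hd' hd0').mul (ha 0 α)).add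
      (((hg' 0 0).div hd' hd0').mul (ha 1 α)))).congr_deriv ?_
    simp
    rw [hE]
    generalize √(d t) = q at *
    rw [hdq]
    field_simp
    ring

/-- The time derivative of `√g g^{ij} ∂_jη^α` (and hence of `√g Δ_g η^α`) for a moving
parametrized surface `η : ℝ × ℝ² → ℝ³`, in terms of the velocity `v = ∂_tη`. -/
theorem time_derivative_surface_laplacian
    (η : ℝ × (Fin 2 → ℝ) → Fin 3 → ℝ) (hη : ContDiff ℝ 2 η)
    (v : ℝ × (Fin 2 → ℝ) → Fin 3 → ℝ)
    (hv : ∀ (p : ℝ × (Fin 2 → ℝ)) (α : Fin 3), v p α = Dt (fun r => η r α) p)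
    (g : Fin 2 → Fin 2 → ℝ × (Fin 2 → ℝ) → ℝ)
    (hg : ∀ (i j : Fin 2) (p : ℝ × (Fin 2 → ℝ)),
      g i j p = ∑ μ : Fin 3, Dx i (fun r => η r μ) p * Dx j (fun r => η r μ) p)
    (ginv : Fin 2 → Fin 2 → ℝ × (Fin 2 → ℝ) → ℝ)
    (hginv₁ : ∀ (i j : Fin 2) (p : ℝ × (Fin 2 → ℝ)),
      ∑ k : Fin 2, g i k p * ginv k j p = if i = j then 1 else 0)
    (hginv₂ : ∀ (i j : Fin 2) (p : ℝ × (Fin 2 → ℝ)),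
      ∑ k : Fin 2, ginv i k p * g k j p = if i = j then 1 else 0)
    (gdet : ℝ × (Fin 2 → ℝ) → ℝ)
    (hgdet : ∀ p : ℝ × (Fin 2 → ℝ), gdet p = g 0 0 p * g 1 1 p - g 0 1 p * g 1 0 p)
    (hgpos : ∀ p : ℝ × (Fin 2 → ℝ), 0 < gdet p) :
    (∀ (p : ℝ × (Fin 2 → ℝ)) (i : Fin 2) (α : Fin 3),
      Dt (fun r => Real.sqrt (gdet r) * ∑ j : Fin 2,
          ginv i j r * Dx j (fun r' => η r' α) r) p
        = (∑ j : Fin 2, ∑ lam : Fin 3,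
            Real.sqrt (gdet p) * ginv i j p *
              ((if α = lam then (1 : ℝ) else 0)
                - ∑ k : Fin 2, ∑ l : Fin 2,
                    ginv k l p * Dx k (fun r => η r α) p * Dx l (fun r => η r lam) p)
              * Dx j (fun r => v r lam) p)
          + ∑ j : Fin 2, ∑ k : Fin 2, ∑ l : Fin 2, ∑ lam : Fin 3,
              Real.sqrt (gdet p) * (ginv i j p * ginv k l p - ginv l j p * ginv i k p)
                * Dx j (fun r => η r α) p * Dx k (fun r => η r lam) p
                * Dx l (fun r => v r lam) p)
    ∧ (ContDiff ℝ 3 η →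
      ∀ (p : ℝ × (Fin 2 → ℝ)) (α : Fin 3),
        Dt (fun r => ∑ i : Fin 2, Dx i (fun r' =>
            Real.sqrt (gdet r') * ∑ j : Fin 2,
              ginv i j r' * Dx j (fun r'' => η r'' α) r') r) p
          = ∑ i : Fin 2, Dx i (fun r =>
              (∑ j : Fin 2, ∑ lam : Fin 3,
                Real.sqrt (gdet r) * ginv i j r *
                  ((if α = lam then (1 : ℝ) else 0)
                    - ∑ k : Fin 2, ∑ l : Fin 2,
                        ginv k l r * Dx k (fun r' => η r' α) r * Dx l (fun r' => η r' lam) r)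
                  * Dx j (fun r' => v r' lam) r)
              + ∑ j : Fin 2, ∑ k : Fin 2, ∑ l : Fin 2, ∑ lam : Fin 3,
                  Real.sqrt (gdet r) * (ginv i j r * ginv k l r - ginv l j r * ginv i k r)
                    * Dx j (fun r' => η r' α) r * Dx k (fun r' => η r' lam) r
                    * Dx l (fun r' => v r' lam) r) p) := by
  have hv' : ∀ α, (fun r => v r α) = Dt fun r => η r α := fun α => funext fun p => hv p α
  have hinv : ∀ p, (fun i j => ginv i j p)
      = ![![g 1 1 p / gdet p, -g 0 1 p / gdet p], ![-g 1 0 p / gdet p, g 0 0 p / gdet p]] :=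
    fun p => inverse_two_by_two (a := fun i j => g i j p) (hgdet p) (hgpos p)
      fun i j => hginv₁ i j p
  have hη2 : ∀ α, ContDiff ℝ ((1 : ℕ) + 1) fun r => η r α := by
    intro α
    convert contDiff_pi.1 hη α using 1
    norm_num
  have hfirst : ∀ (p : ℝ × (Fin 2 → ℝ)) (i : Fin 2) (α : Fin 3), _ = _ := fun p i α =>
    (hasDerivAt_sqrt_det_mul_inverse_gram (t := p.1)
      (a := fun j μ s => Dx j (fun r => η r μ) (s, p.2))
      (w := fun j μ => Dx j (fun r => v r μ) p)
      (g := fun i j s => g i j (s, p.2)) (ginv := fun i j s => ginv i j (s, p.2))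
      (d := fun s => gdet (s, p.2))
      (fun j μ => by
        rw [hv', ← Dt_Dx_comm j (contDiff_pi.1 hη μ)]
        exact hasDerivAt_Dt ((contDiff_Dx j (hη2 μ)).differentiable (by simp)) p)
      (fun i j s => hg i j _) (fun s => hgdet _) (fun s => hgpos _) (fun s => hinv _) i α).deriv
  refine ⟨hfirst, fun hη3 p α => ?_⟩
  have hη3' : ∀ μ, ContDiff ℝ ((2 : ℕ) + 1) fun r => η r μ := by
    intro μ
    convert contDiff_pi.1 hη3 μ using 1
    norm_num
  have hgC : ∀ i j, ContDiff ℝ (2 : ℕ) (g i j) := by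
    intro i j
    rw [funext (hg i j)]
    exact ContDiff.sum fun μ _ => (contDiff_Dx i (hη3' μ)).mul (contDiff_Dx j (hη3' μ))
  have hdC : ContDiff ℝ (2 : ℕ) gdet := by
    rw [funext hgdet]
    exact ((hgC 0 0).mul (hgC 1 1)).sub ((hgC 0 1).mul (hgC 1 0))
  have hd0 : ∀ r, gdet r ≠ 0 := fun r => (hgpos r).ne'
  have hiC : ∀ i j, ContDiff ℝ (2 : ℕ) (ginv i j) := by
    intro i j
    have h := fun p => congrFun (congrFun (hinv p) i) j
    rw [funext h]
    fin_cases i <;> fin_cases j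
    · exact (hgC 1 1).div hdC hd0
    · exact (hgC 0 1).neg.div hdC hd0
    · exact (hgC 1 0).neg.div hdC hd0
    · exact (hgC 0 0).div hdC hd0
  have hF : ∀ i, ContDiff ℝ (2 : ℕ) fun r => √(gdet r) * ∑ j : Fin 2,
      ginv i j r * Dx j (fun r' => η r' α) r := fun i =>
    (hdC.sqrt hd0).mul (ContDiff.sum fun j _ => (hiC i j).mul (contDiff_Dx j (hη3' α)))
  rw [Dt_sum _ fun i _ => (contDiff_Dx (n := 1) i (hF i)).differentiable (by simp)]
  refine Finset.sum_congr rfl fun i _ => ?_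
  rw [Dt_Dx_comm i (hF i)]
  congr 1
  exact funext fun r => hfirst r i α
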